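/- Let u₁, u₂ : ℝ² → ℝ² be smooth ℤ²-periodic divergence-free velocity fields, let θ_in : ℝ² → ℝ be smooth and ℤ²-periodic, let κ > 0, and let θ₁, θ₂ : [0,1]×ℝ² → ℝ be smooth classical solutions of the advection–diffusion equation with diffusivity κ, initial datum θ_in, and velocities u₁ and u₂ respectively. Then for every t ∈ (0,1): ∫_{[0,1]²} |θ₁(t,x) − θ₂(t,x)|² dx + κ ∫₀^t ∫_{[0,1]²} |∇(θ₁ − θ₂)(s,x)|² dx ds ≤ (‖θ_in‖_{L∞}² / κ) ∫₀^t ∫_{[0,1]²} |u₁(x) − u₂(x)|² dx ds. -/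

import Mathlib

open MeasureTheory

noncomputable section

/-- The plane `ℝ²` as a Euclidean space. -/
abbrev E2 := EuclideanSpace ℝ (Fin 2)

/-- `ℤ²`-periodicity of a function on `ℝ²`. -/
def Per {F : Type*} [AddCommGroup F] (f : E2 → F) : Prop :=
  ∀ (x : E2) (k : Fin 2 → ℤ),
    f (x + (WithLp.equiv 2 (Fin 2 → ℝ)).symm (fun i => (k i : ℝ))) = f x

/-- The periodicity cell `[0,1]²`, identified with the torus `𝕋²`. -/
def cube : Set E2 := {x | ∀ i, x i ∈ Set.Icc (0:ℝ) 1}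

/-- The Laplacian of a function on `ℝ²`: sum of second partial derivatives. -/
def lap (f : E2 → ℝ) (x : E2) : ℝ :=
  ∑ i : Fin 2, fderiv ℝ (fun y => fderiv ℝ f y (EuclideanSpace.single i 1)) x
    (EuclideanSpace.single i 1)

/-- Pointwise divergence-freeness of a smooth vector field on `ℝ²`. -/
def DivFree (u : E2 → E2) : Prop :=
  ∀ x : E2, (∑ i : Fin 2, fderiv ℝ u x (EuclideanSpace.single i 1) i) = 0

/-- A classical solution of the advection–diffusion equation
`∂ₜθ + u·∇θ = κ Δθ`, `θ(0,·) = θin` on `[0,1] × ℝ²`. -/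
def IsClassicalSolution (κ : ℝ) (u : E2 → E2) (θin : E2 → ℝ) (θ : ℝ → E2 → ℝ) : Prop :=
  (∃ C, ∀ t x, |θ t x| ≤ C) ∧
  (∀ t, Per (θ t)) ∧
  ContinuousOn (fun p : ℝ × E2 => θ p.1 p.2) (Set.Icc 0 1 ×ˢ (Set.univ : Set E2)) ∧
  (∀ x : E2, ∀ t ∈ Set.Ioc (0:ℝ) 1, DifferentiableAt ℝ (fun s => θ s x) t) ∧
  ContinuousOn (fun p : ℝ × E2 => deriv (fun s => θ s p.2) p.1)
    (Set.Ioc 0 1 ×ˢ (Set.univ : Set E2)) ∧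
  (∀ t ∈ Set.Ioc (0:ℝ) 1, ContDiff ℝ 2 (θ t)) ∧
  (∀ t ∈ Set.Ioc (0:ℝ) 1, ∀ x,
    deriv (fun s => θ s x) t + fderiv ℝ (θ t) x (u x) = κ * lap (θ t) x) ∧
  (∀ x, θ 0 x = θin x)


lemma isCompact_cube : IsCompact cube := by
  have h : cube = WithLp.ofLp ⁻¹' (Set.Icc (0 : Fin 2 → ℝ) 1) := by
    ext x
    simp [cube, Set.mem_Icc, Pi.le_def, forall_and]
  rw [h]
  exact (PiLp.homeomorph 2 (fun _ : Fin 2 => ℝ)).isCompact_preimage.2 isCompact_Icc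

lemma setIntegral_cube (g : E2 → ℝ) :
    ∫ x in cube, g x = ∫ y in Set.Icc (0 : Fin 2 → ℝ) 1, g (WithLp.toLp 2 y) := by
  have h : WithLp.toLp 2 ⁻¹' cube = Set.Icc (0 : Fin 2 → ℝ) 1 := by
    ext x
    simp [cube, Set.mem_Icc, Pi.le_def, forall_and]
  rw [← h]
  exact ((PiLp.volume_preserving_toLp (Fin 2)).setIntegral_preimage_emb
    (MeasurableEquiv.toLp 2 (Fin 2 → ℝ)).measurableEmbedding g cube).symm

lemma Per.add_single {F : Type*} [AddCommGroup F] {f : E2 → F} (hf : Per f) (x : E2) (i : Fin 2) :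
    f (x + EuclideanSpace.single i 1) = f x := by
  rw [← hf x (Pi.single i 1)]
  congr 2
  ext j
  by_cases h : j = i
  · subst h; simp
  · simp [h]

/-- A directional derivative of a periodic function has zero mean. -/
lemma Per.setIntegral_fderiv_single {f : E2 → ℝ} (hf : Per f) (hd : ContDiff ℝ 1 f) (i : Fin 2) :
    ∫ x in cube, fderiv ℝ f x (EuclideanSpace.single i 1) = 0 := by
  rw [setIntegral_cube]
  set L := (PiLp.continuousLinearEquiv 2 ℝ (fun _ : Fin 2 => ℝ)).symm with hL
  have hd' : ∀ y, HasFDerivAt (fun y : Fin 2 → ℝ => f (WithLp.toLp 2 y))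
      ((fderiv ℝ f (WithLp.toLp 2 y)).comp (L : (Fin 2 → ℝ) →L[ℝ] E2)) y := fun y =>
    ((hd.differentiable one_ne_zero) (L y)).hasFDerivAt.comp y L.hasFDerivAt
  have hc : Continuous fun y : Fin 2 → ℝ =>
      fderiv ℝ f (WithLp.toLp 2 y) (EuclideanSpace.single i 1) :=
    ((hd.continuous_fderiv one_ne_zero).comp L.continuous).clm_apply continuous_const
  have key := integral_divergence_of_hasFDerivAt_off_countable' (n := 1) (0 : Fin 2 → ℝ) 1
    zero_le_one
    (fun j => if j = i then (fun y : Fin 2 → ℝ => f (WithLp.toLp 2 y)) else fun _ => 0)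
    (fun j y => if j = i then
      (fderiv ℝ f (WithLp.toLp 2 y)).comp (L : (Fin 2 → ℝ) →L[ℝ] E2) else 0)
    ∅ Set.countable_empty
    (fun j => by
      by_cases h : j = i
      · simp only [h, if_true]
        exact fun y _ => (hd' y).continuousAt.continuousWithinAt
      · simpa only [h, if_false] using continuousOn_const)
    (fun y _ j => by
      by_cases h : j = i
      · simpa only [h, if_true] using hd' y
      · simpa only [h, if_false] using hasFDerivAt_const _ _)
  have hsum : ∀ y : Fin 2 → ℝ, ∑ j : Fin 2, (if j = i then
      (fderiv ℝ f (WithLp.toLp 2 y)).comp (L : (Fin 2 → ℝ) →L[ℝ] E2) else 0) (Pi.single j 1)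
      = fderiv ℝ f (WithLp.toLp 2 y) (EuclideanSpace.single i 1) := fun y => by
    rw [Finset.sum_eq_single i]
    · simp [hL]
    · intro j _ h; simp [h]
    · simp
  simp only [hsum] at key
  rw [key (hc.continuousOn.integrableOn_compact isCompact_Icc)]
  refine Finset.sum_eq_zero fun j _ => ?_
  by_cases h : j = i
  · subst h
    simp only [if_true, sub_eq_zero]
    congr 1
    ext y
    rw [← hf.add_single (WithLp.toLp 2 (j.insertNth ((0 : Fin 2 → ℝ) j) y)) j]
    congr 1
    ext k
    refine Fin.succAboveCases j ?_ (fun k => ?_) k <;> simp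
  · simp [h]

lemma clm_apply_eq_sum (L : E2 →L[ℝ] ℝ) (v : E2) :
    L v = ∑ i : Fin 2, L (EuclideanSpace.single i 1) * v i := by
  conv_lhs => rw [← (EuclideanSpace.basisFun (Fin 2) ℝ).sum_repr v]
  simp [mul_comm]

lemma norm_sq_le_sum_sq (L : E2 →L[ℝ] ℝ) :
    ‖L‖ ^ 2 ≤ ∑ i : Fin 2, (L (EuclideanSpace.single i 1)) ^ 2 := by
  have hS0 : 0 ≤ ∑ i : Fin 2, (L (EuclideanSpace.single i 1)) ^ 2 :=
    Finset.sum_nonneg fun i _ => sq_nonneg _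
  refine (pow_le_pow_left₀ (norm_nonneg _) (L.opNorm_le_bound (Real.sqrt_nonneg _) fun v => ?_)
    2).trans_eq (Real.sq_sqrt hS0)
  rw [clm_apply_eq_sum, EuclideanSpace.norm_eq v, ← Real.sqrt_mul hS0, Real.norm_eq_abs]
  refine Real.abs_le_sqrt ?_
  simpa using Finset.sum_mul_sq_le_sq_mul_sq Finset.univ
    (fun i : Fin 2 => L (EuclideanSpace.single i 1)) (fun i => v i)

lemma IsLocalMax.deriv_deriv_nonpos {f : ℝ → ℝ} {x : ℝ} (h : IsLocalMax f x)
    (hc : ContinuousAt f x) : deriv (deriv f) x ≤ 0 := by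
  by_contra! hpos
  have hmin := isLocalMin_of_deriv_deriv_pos hpos h.deriv_eq_zero hc
  have heq : f =ᶠ[nhds x] fun _ => f x := by
    filter_upwards [h, hmin] with y h1 h2 using le_antisymm h1 h2
  have := heq.deriv.deriv_eq
  simp at this
  linarith

lemma IsLocalMax.lap_nonpos {f : E2 → ℝ} {x : E2} (h : IsLocalMax f x) (hf : ContDiff ℝ 2 f) :
    lap f x ≤ 0 := by
  refine Finset.sum_nonpos fun i _ => ?_
  set e : E2 := EuclideanSpace.single i 1
  have hline : ∀ r : ℝ, HasDerivAt (fun r : ℝ => x + r • e) e r := fun r => by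
    simpa using ((hasDerivAt_id r).smul_const e).const_add x
  have hcomp : ∀ {g : E2 → ℝ}, Differentiable ℝ g → ∀ r : ℝ,
      HasDerivAt (fun r : ℝ => g (x + r • e)) (fderiv ℝ g (x + r • e) e) r := fun hg r =>
    (hg _).hasFDerivAt.comp_hasDerivAt r (hline r)
  have hd : Differentiable ℝ fun y => fderiv ℝ f y e :=
    ((hf.fderiv_right (m := 1) (by norm_num)).clm_apply contDiff_const).differentiable one_ne_zero
  have h1 : deriv (fun r : ℝ => f (x + r • e)) = fun r => fderiv ℝ f (x + r • e) e :=
    funext fun r => (hcomp (hf.differentiable two_ne_zero) r).deriv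
  have h2 := (hcomp hd 0).deriv
  rw [← h1] at h2
  simp only [zero_smul, add_zero] at h2
  rw [← h2]
  have hline0 : ContinuousAt (fun r : ℝ => x + r • e) 0 := (hline 0).continuousAt
  refine IsLocalMax.deriv_deriv_nonpos ?_ (hcomp (hf.differentiable two_ne_zero) 0).continuousAt
  have : Filter.Tendsto (fun r : ℝ => x + r • e) (nhds 0) (nhds x) := by
    simpa [ContinuousAt] using hline0
  simpa [IsLocalMax, IsMaxFilter] using this.eventually h

lemma Per.exists_mem_cube {F : Type*} [AddCommGroup F] (x : E2) :
    ∃ y ∈ cube, ∀ f : E2 → F, Per f → f y = f x := by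
  refine ⟨WithLp.toLp 2 fun i => Int.fract (x i),
    fun i => ⟨Int.fract_nonneg _, (Int.fract_lt_one _).le⟩, fun f hf => ?_⟩
  rw [← hf _ fun i => ⌊x i⌋]
  congr 1
  ext i
  simp

/-- Weak maximum principle. -/
lemma IsClassicalSolution.le_of_initial_le {κ : ℝ} (hκ : 0 < κ) {u : E2 → E2} {θin : E2 → ℝ}
    {θ : ℝ → E2 → ℝ} (h : IsClassicalSolution κ u θin θ) {M : ℝ} (hM : ∀ x, θin x ≤ M)
    {t : ℝ} (ht : t ∈ Set.Icc (0 : ℝ) 1) (x : E2) : θ t x ≤ M := by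
  obtain ⟨-, hper, hcont, hdt, -, hC2, heq, h0⟩ := h
  refine le_of_forall_pos_le_add fun ε hε => ?_
  obtain ⟨⟨t₀, x₀⟩, ⟨ht₀, hx₀⟩, hmax⟩ := (isCompact_Icc.prod isCompact_cube).exists_isMaxOn
    (f := fun p : ℝ × E2 => θ p.1 p.2 - ε * p.1) ⟨(t, 0), ht, fun i => by simp⟩
    ((hcont.mono (Set.prod_mono_right (Set.subset_univ _))).sub (by fun_prop))
  have hmax' : ∀ s ∈ Set.Icc (0 : ℝ) 1, ∀ y, θ s y - ε * s ≤ θ t₀ x₀ - ε * t₀ := fun s hs y => by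
    obtain ⟨z, hz, hzy⟩ := Per.exists_mem_cube (F := ℝ) y
    rw [← hzy _ (hper s)]
    exact hmax (Set.mk_mem_prod hs hz)
  have hbound : θ t₀ x₀ - ε * t₀ ≤ M := by
    rcases ht₀.1.eq_or_lt with h | hpos
    · obtain rfl : 0 = t₀ := h
      simpa [h0] using hM x₀
    have ht₀' : t₀ ∈ Set.Ioc (0 : ℝ) 1 := ⟨hpos, ht₀.2⟩
    have hloc : IsLocalMax (θ t₀) x₀ := Filter.Eventually.of_forall fun y => by
      simpa using hmax' t₀ ht₀ y
    have hpde := heq t₀ ht₀' x₀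
    rw [hloc.fderiv_eq_zero] at hpde
    have hlap := hloc.lap_nonpos (hC2 t₀ ht₀')
    have hderiv : ε ≤ deriv (fun s => θ s x₀) t₀ := by
      have hs := hasDerivWithinAt_iff_tendsto_slope.1
        ((hdt x₀ t₀ ht₀').hasDerivAt.hasDerivWithinAt (s := Set.Iio t₀))
      rw [Set.sdiff_singleton_eq_self (by simp)] at hs
      refine ge_of_tendsto hs ?_
      filter_upwards [Ioo_mem_nhdsLT hpos] with s hs
      have := hmax' s ⟨hs.1.le, hs.2.le.trans ht₀.2⟩ x₀
      rw [slope_def_field, le_div_iff_of_neg (sub_neg.2 hs.2)]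
      linarith
    simp at hpde
    nlinarith
  have := hmax' t ht x
  have : ε * t ≤ ε := mul_le_of_le_one_right hε.le ht.2
  have : 0 ≤ ε * t₀ := mul_nonneg hε.le ht₀.1
  linarith

lemma IsClassicalSolution.neg {κ : ℝ} {u : E2 → E2} {θin : E2 → ℝ} {θ : ℝ → E2 → ℝ}
    (h : IsClassicalSolution κ u θin θ) :
    IsClassicalSolution κ u (fun x => -θin x) (fun t x => -θ t x) := by
  obtain ⟨⟨C, hC⟩, hper, hcont, hdt, hdtc, hC2, heq, h0⟩ := h
  refine ⟨⟨C, fun t x => by simpa using hC t x⟩, fun t x k => congrArg Neg.neg (hper t x k), hcont.neg,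
    fun x t ht => (hdt x t ht).neg, ?_, fun t ht => (hC2 t ht).neg, fun t ht x => ?_,
    fun x => congrArg Neg.neg (h0 x)⟩
  · simp only [deriv.fun_neg]
    exact hdtc.neg
  · have := heq t ht x
    simp only [deriv.fun_neg, lap, fderiv_fun_neg, neg_apply,
      Finset.sum_neg_distrib] at this ⊢
    linarith

lemma IsClassicalSolution.abs_le {κ : ℝ} (hκ : 0 < κ) {u : E2 → E2} {θin : E2 → ℝ}
    {θ : ℝ → E2 → ℝ} (h : IsClassicalSolution κ u θin θ)
    {t : ℝ} (ht : t ∈ Set.Icc (0 : ℝ) 1) (x : E2) : |θ t x| ≤ ⨆ y, |θin y| := by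
  obtain ⟨C, hC⟩ := h.1
  have hbdd : BddAbove (Set.range fun y => |θin y|) :=
    ⟨C, by rintro _ ⟨y, rfl⟩; simpa only [h.2.2.2.2.2.2.2 y] using hC 0 y⟩
  have hle : ∀ y, |θin y| ≤ ⨆ y, |θin y| := le_ciSup hbdd
  refine abs_le'.2 ⟨h.le_of_initial_le hκ (fun y => (le_abs_self _).trans (hle y)) ht x,
    h.neg.le_of_initial_le hκ (fun y => (neg_le_abs _).trans (hle y)) ht x⟩

lemma energy_dissipation {κ M : ℝ} (hκ : 0 < κ) {f w : E2 → ℝ} {u a : E2 → E2}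
    (hf : ContDiff ℝ 2 f) (hw : ContDiff ℝ 2 w) (hu : ContDiff ℝ 1 u) (ha : ContDiff ℝ 1 a)
    (hfper : Per f) (hwper : Per w) (huper : Per u) (haper : Per a)
    (hudiv : DivFree u) (hadiv : DivFree a) (hM : ∀ x, |f x| ≤ M) :
    ∫ x in cube, 2 * w x * (κ * lap w x - fderiv ℝ w x (u x) - fderiv ℝ f x (a x)) ≤
      -κ * (∫ x in cube, ‖fderiv ℝ w x‖ ^ 2) + M ^ 2 / κ * ∫ x in cube, ‖a x‖ ^ 2 := by
  have hint : ∀ {g : E2 → ℝ}, Continuous g → IntegrableOn g cube := fun hg =>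
    hg.continuousOn.integrableOn_compact isCompact_cube
  have hdw : ∀ i : Fin 2, ContDiff ℝ 1 fun y => fderiv ℝ w y (EuclideanSpace.single i 1) :=
    fun i => (hw.fderiv_right (m := 1) (by norm_num)).clm_apply contDiff_const
  have hcoord : ∀ {v : E2 → E2}, ContDiff ℝ 1 v → ∀ i : Fin 2, ContDiff ℝ 1 fun y => v y i :=
    fun hv i => contDiff_euclidean.1 hv i
  set F : Fin 2 → E2 → ℝ := fun i x => 2 * κ * (w x * fderiv ℝ w x (EuclideanSpace.single i 1))
    - w x * w x * u x i - 2 * (w x * f x * a x i) with hF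
  have hw1 : ContDiff ℝ 1 w := hw.of_le one_le_two
  have hf1 : ContDiff ℝ 1 f := hf.of_le one_le_two
  have hFC : ∀ i, ContDiff ℝ 1 (F i) := fun i =>
    ((contDiff_const.mul (hw1.mul (hdw i))).sub ((hw1.mul hw1).mul (hcoord hu i))).sub
      (contDiff_const.mul ((hw1.mul hf1).mul (hcoord ha i)))
  have hFper : ∀ i, Per (F i) := fun i x k => by
    have hd : fderiv ℝ w (x + (WithLp.equiv 2 (Fin 2 → ℝ)).symm fun i => (k i : ℝ)) =
        fderiv ℝ w x := by
      rw [← fderiv_comp_add_right]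
      exact congrArg (fun g => fderiv ℝ g x) (funext fun y => hwper y k)
    simp only [hF, hd, hwper x k, hfper x k, huper x k, haper x k]
  have hdiv : ∫ x in cube, ∑ i, fderiv ℝ (F i) x (EuclideanSpace.single i 1) = 0 := by
    rw [integral_finsetSum _ fun i _ => hint
      (((hFC i).continuous_fderiv one_ne_zero).clm_apply continuous_const)]
    exact Finset.sum_eq_zero fun i _ => (hFper i).setIntegral_fderiv_single (hFC i) i
  have hFd : ∀ x, ∑ i, fderiv ℝ (F i) x (EuclideanSpace.single i 1) =
      2 * κ * ∑ i : Fin 2, (fderiv ℝ w x (EuclideanSpace.single i 1)) ^ 2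
        - 2 * f x * fderiv ℝ w x (a x)
        + 2 * w x * (κ * lap w x - fderiv ℝ w x (u x) - fderiv ℝ f x (a x)) := fun x => by
    have hwx := (hw1.differentiable one_ne_zero x).hasFDerivAt
    have hfx := (hf1.differentiable one_ne_zero x).hasFDerivAt
    have hcx : ∀ {v : E2 → E2}, ContDiff ℝ 1 v → ∀ i : Fin 2, HasFDerivAt (fun y => v y i)
        ((EuclideanSpace.proj i : E2 →L[ℝ] ℝ).comp (fderiv ℝ v x)) x := fun hv i =>
      (EuclideanSpace.proj i : E2 →L[ℝ] ℝ).hasFDerivAt.comp x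
        (hv.differentiable one_ne_zero x).hasFDerivAt
    have hFi : ∀ i, fderiv ℝ (F i) x = _ := fun i =>
      ((((hwx.mul ((hdw i).differentiable one_ne_zero x).hasFDerivAt).const_mul (2 * κ)).sub
        ((hwx.mul hwx).mul (hcx hu i))).sub
        (((hwx.mul hfx).mul (hcx ha i)).const_mul 2)).fderiv
    have h1 := hudiv x
    have h2 := hadiv x
    rw [clm_apply_eq_sum _ (u x), clm_apply_eq_sum _ (a x), clm_apply_eq_sum _ (a x)]
    simp only [hFi, lap, Fin.sum_univ_two] at h1 h2 ⊢
    simp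
    linear_combination (- w x * w x) * h1 - 2 * w x * f x * h2
  have hcw := hw.continuous_fderiv two_ne_zero
  have hcf := hf.continuous_fderiv two_ne_zero
  have hlap : Continuous (lap w) := continuous_finsetSum _ fun i _ =>
    ((hdw i).continuous_fderiv one_ne_zero).clm_apply continuous_const
  have hD : Continuous fun x =>
      2 * w x * (κ * lap w x - fderiv ℝ w x (u x) - fderiv ℝ f x (a x)) := by
    have := hw.continuous
    have := hcw.clm_apply hu.continuous
    have := hcf.clm_apply ha.continuous
    fun_prop
  have hDiv : Continuous fun x => ∑ i, fderiv ℝ (F i) x (EuclideanSpace.single i 1) :=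
    continuous_finsetSum _ fun i _ =>
      ((hFC i).continuous_fderiv one_ne_zero).clm_apply continuous_const
  have hg : Continuous fun x => -κ * ‖fderiv ℝ w x‖ ^ 2 :=
    continuous_const.mul (hcw.norm.pow 2)
  have hA : Continuous fun x => M ^ 2 / κ * ‖a x‖ ^ 2 :=
    continuous_const.mul (ha.continuous.norm.pow 2)
  rw [← integral_const_mul, ← integral_const_mul,
    ← integral_add (hint hg) (hint hA),
    ← sub_zero (∫ x in cube, 2 * w x * _), ← hdiv, ← integral_sub (hint hD) (hint hDiv)]
  refine setIntegral_mono (hint (hD.sub hDiv))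
    (hint (hg.add hA)) fun x => ?_
  have h1 := norm_sq_le_sum_sq (fderiv ℝ w x)
  have h2 : |f x * fderiv ℝ w x (a x)| ≤ M * (‖fderiv ℝ w x‖ * ‖a x‖) := by
    rw [abs_mul]
    exact mul_le_mul (hM x) ((fderiv ℝ w x).le_opNorm _) (abs_nonneg _)
      ((abs_nonneg _).trans (hM x))
  have h3 : 2 * (M * (‖fderiv ℝ w x‖ * ‖a x‖)) ≤
      κ * ‖fderiv ℝ w x‖ ^ 2 + M ^ 2 / κ * ‖a x‖ ^ 2 := by
    have : 0 ≤ (κ * ‖fderiv ℝ w x‖ - M * ‖a x‖) ^ 2 / κ := by positivity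
    have h4 : (κ * ‖fderiv ℝ w x‖ - M * ‖a x‖) ^ 2 / κ = κ * ‖fderiv ℝ w x‖ ^ 2
        + M ^ 2 / κ * ‖a x‖ ^ 2 - 2 * (M * (‖fderiv ℝ w x‖ * ‖a x‖)) := by
      field_simp
      ring
    linarith
  have h5 := le_abs_self (f x * fderiv ℝ w x (a x))
  have h6 := mul_le_mul_of_nonneg_left h1 hκ.le
  simp only [hFd]
  linarith

/-- **Stability estimate for the advection–diffusion equation with respect to the velocity.**
If `θ₁, θ₂` are smooth classical solutions with the same diffusivity `κ > 0` and initial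
datum `θin` but different smooth periodic divergence-free velocities `u₁, u₂`, then for all
`t ∈ (0,1)`:
`∫|θ₁−θ₂|²(t) + κ∫₀ᵗ∫|∇(θ₁−θ₂)|² ≤ (‖θin‖_∞²/κ) ∫₀ᵗ∫|u₁−u₂|²`. -/
theorem advection_diffusion_velocity_stability
    (u₁ u₂ : E2 → E2) (hu₁ : ContDiff ℝ (⊤ : ℕ∞) u₁) (hu₂ : ContDiff ℝ (⊤ : ℕ∞) u₂)
    (hu₁per : Per u₁) (hu₂per : Per u₂)
    (hu₁div : DivFree u₁) (hu₂div : DivFree u₂)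
    (θin : E2 → ℝ) (hθin : ContDiff ℝ (⊤ : ℕ∞) θin) (hθinper : Per θin)
    (κ : ℝ) (hκ : 0 < κ)
    (θ₁ θ₂ : ℝ → E2 → ℝ)
    (hθ₁smooth : ContDiff ℝ (⊤ : ℕ∞) (fun p : ℝ × E2 => θ₁ p.1 p.2))
    (hθ₂smooth : ContDiff ℝ (⊤ : ℕ∞) (fun p : ℝ × E2 => θ₂ p.1 p.2))
    (hθ₁ : IsClassicalSolution κ u₁ θin θ₁)
    (hθ₂ : IsClassicalSolution κ u₂ θin θ₂) :
    ∀ t ∈ Set.Ioo (0:ℝ) 1,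
      (∫ x in cube, |θ₁ t x - θ₂ t x| ^ 2) +
        κ * ∫ s in Set.Icc (0:ℝ) t, ∫ x in cube, ‖fderiv ℝ (θ₁ s) x - fderiv ℝ (θ₂ s) x‖ ^ 2 ≤
      ((⨆ x : E2, |θin x|) ^ 2 / κ) *
        ∫ s in Set.Icc (0:ℝ) t, ∫ x in cube, ‖u₁ x - u₂ x‖ ^ 2 := by
  intro t ht
  set M := ⨆ x, |θin x|
  set W : ℝ × E2 → ℝ := fun p => θ₁ p.1 p.2 - θ₂ p.1 p.2 with hW
  have hWC : ContDiff ℝ (⊤ : ℕ∞) W := hθ₁smooth.sub hθ₂smooth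
  have hdtime : ∀ (x : E2) (s : ℝ),
      HasDerivAt (fun r => W (r, x)) (deriv (fun r => W (r, x)) s) s := fun x s =>
    ((hWC.comp (contDiff_id.prodMk contDiff_const)).differentiable (by simp) s).hasDerivAt
  set D : ℝ → E2 → ℝ := fun s x => 2 * W (s, x) * deriv (fun r => W (r, x)) s with hDdef
  have hDcont : Continuous (Function.uncurry D) := by
    have h1 : Continuous fun p : ℝ × E2 => fderiv ℝ (fun r => W (r, p.2)) p.1 :=
      (ContDiff.fderiv (f := fun (p : ℝ × E2) (r : ℝ) => W (r, p.2)) (g := fun p : ℝ × E2 => p.1)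
        (m := (⊤ : ℕ∞)) (n := 0) (hWC.comp (contDiff_snd.prodMk (contDiff_snd.comp contDiff_fst)))
        contDiff_fst (by simp)).continuous
    have h2 : Continuous fun p : ℝ × E2 => deriv (fun r => W (r, p.2)) p.1 :=
      h1.clm_apply continuous_const
    exact (continuous_const.mul hWC.continuous).mul h2
  have hGcont : Continuous (Function.uncurry fun (s : ℝ) (x : E2) =>
      ‖fderiv ℝ (θ₁ s) x - fderiv ℝ (θ₂ s) x‖ ^ 2) := by
    have h : ∀ (g : ℝ → E2 → ℝ), ContDiff ℝ (⊤ : ℕ∞) (fun p : ℝ × E2 => g p.1 p.2) →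
        Continuous fun p : ℝ × E2 => fderiv ℝ (g p.1) p.2 := fun g hg =>
      (ContDiff.fderiv (f := fun p : ℝ × E2 => g p.1) (g := fun p : ℝ × E2 => p.2)
        (m := (⊤ : ℕ∞)) (n := 0) (hg.comp ((contDiff_fst.comp contDiff_fst).prodMk contDiff_snd))
        contDiff_snd (by simp)).continuous
    exact ((h θ₁ hθ₁smooth).sub (h θ₂ hθ₂smooth)).norm.pow 2
  have hDx := continuous_parametric_integral_of_continuous (μ := volume) hDcont isCompact_cube
  have hGx := continuous_parametric_integral_of_continuous (μ := volume) hGcont isCompact_cube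
  have hslice : ∀ s ∈ Set.Ioc (0 : ℝ) 1, ∫ x in cube, D s x ≤
      -κ * (∫ x in cube, ‖fderiv ℝ (θ₁ s) x - fderiv ℝ (θ₂ s) x‖ ^ 2)
        + M ^ 2 / κ * ∫ x in cube, ‖u₁ x - u₂ x‖ ^ 2 := fun s hs => by
    have hC₁ := hθ₁.2.2.2.2.2.1 s hs
    have hC₂ := hθ₂.2.2.2.2.2.1 s hs
    have hU₁ := hu₁.of_le (m := 1) (by simp)
    have hU₂ := hu₂.of_le (m := 1) (by simp)
    have hgrad : ∀ x, fderiv ℝ (fun y => θ₁ s y - θ₂ s y) x =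
        fderiv ℝ (θ₁ s) x - fderiv ℝ (θ₂ s) x := fun x =>
      fderiv_fun_sub (hC₁.differentiable two_ne_zero x) (hC₂.differentiable two_ne_zero x)
    have key := energy_dissipation (M := M) hκ hC₂ (hC₁.sub hC₂) hU₁ (hU₁.sub hU₂)
      (hθ₂.2.1 s) (fun x k => by rw [hθ₁.2.1 s x k, hθ₂.2.1 s x k]) hu₁per
      (fun x k => by rw [hu₁per x k, hu₂per x k]) hu₁div
      (fun x => by
        have h1 := hu₁div x
        have h2 := hu₂div x
        rw [fderiv_fun_sub (hU₁.differentiable one_ne_zero x) (hU₂.differentiable one_ne_zero x)]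
        simp only [sub_apply, PiLp.sub_apply, Finset.sum_sub_distrib, h1, h2, sub_zero])
      (fun x => hθ₂.abs_le hκ ⟨hs.1.le, hs.2⟩ x)
    simp only [hgrad] at key
    refine le_of_eq_of_le (congrArg (fun g : E2 → ℝ => ∫ x in cube, g x) (funext fun x => ?_)) key
    have h1 := hθ₁.2.2.2.2.2.2.1 s hs x
    have h2 := hθ₂.2.2.2.2.2.2.1 s hs x
    have hdt : deriv (fun r => θ₁ r x - θ₂ r x) s =
        deriv (fun r => θ₁ r x) s - deriv (fun r => θ₂ r x) s :=
      deriv_fun_sub (hθ₁.2.2.2.1 x s hs) (hθ₂.2.2.2.1 x s hs)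
    have hlap : lap (fun y => θ₁ s y - θ₂ s y) x = lap (θ₁ s) x - lap (θ₂ s) x := by
      have hd : ∀ {g : E2 → ℝ}, ContDiff ℝ 2 g → ∀ i : Fin 2,
          DifferentiableAt ℝ (fun y => fderiv ℝ g y (EuclideanSpace.single i 1)) x := fun hg i =>
        ((hg.fderiv_right (m := 1) (by norm_num)).clm_apply contDiff_const).differentiable
          one_ne_zero x
      simp only [lap, hgrad, sub_apply, ← Finset.sum_sub_distrib]
      exact Finset.sum_congr rfl fun i _ => by
        rw [fderiv_fun_sub (hd hC₁ i) (hd hC₂ i), sub_apply]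
    simp only [hDdef, hW, hdt, hlap, sub_apply, map_sub]
    linear_combination 2 * (θ₁ s x - θ₂ s x) * (h1 - h2)
  have hftc : ∀ x, ∫ s in (0 : ℝ)..t, D s x = |θ₁ t x - θ₂ t x| ^ 2 := fun x => by
    have hc : Continuous fun s => D s x := hDcont.comp (continuous_id.prodMk continuous_const)
    rw [intervalIntegral.integral_eq_sub_of_hasDerivAt (f := fun s => W (s, x) ^ 2)
      (fun s _ => by simpa [hDdef] using (hdtime x s).fun_pow 2) (hc.intervalIntegrable _ _)]
    simp [hW, hθ₁.2.2.2.2.2.2.2, hθ₂.2.2.2.2.2.2.2, sq_abs]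
  have hswap : ∫ s in (0 : ℝ)..t, ∫ x in cube, D s x = ∫ x in cube, |θ₁ t x - θ₂ t x| ^ 2 := by
    rw [intervalIntegral_integral_swap]
    · simp only [hftc]
    · rw [Measure.prod_restrict]
      refine (hDcont.continuousOn.integrableOn_compact
        ((isCompact_uIcc (a := 0) (b := t)).prod isCompact_cube)).mono_set ?_
      exact Set.prod_mono_left Set.uIoc_subset_uIcc
  have hg : Continuous fun s => -κ * ∫ x in cube, ‖fderiv ℝ (θ₁ s) x - fderiv ℝ (θ₂ s) x‖ ^ 2 :=
    continuous_const.mul hGx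
  have hA : Continuous fun _ : ℝ => M ^ 2 / κ * ∫ x in cube, ‖u₁ x - u₂ x‖ ^ 2 := continuous_const
  have hmain := intervalIntegral.integral_mono_on_of_le_Ioo ht.1.le
    (hDx.intervalIntegrable (μ := volume) 0 t) ((hg.add hA).intervalIntegrable 0 t)
    fun s hs => hslice s ⟨hs.1, hs.2.le.trans ht.2.le⟩
  simp only [Pi.add_apply] at hmain
  rw [hswap, intervalIntegral.integral_add (hg.intervalIntegrable 0 t)
    (hA.intervalIntegrable 0 t), intervalIntegral.integral_const_mul,
    intervalIntegral.integral_const_mul] at hmain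
  simp only [integral_Icc_eq_integral_Ioc, ← intervalIntegral.integral_of_le ht.1.le]
  linarith

end
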